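/- arXiv:1809.03751 — 6 statements merged into one kernel-verified Lean document; each statement's English description precedes it below -/
import Mathlib

section
/- Let r, N be positive integers with N ≤ r. Let Ω, Q ∈ ℂ^{r×r} be Hermitian positive semidefinite matrices with QΩ = 0, let A ∈ ℂ^{r×r} be Hermitian positive definite, let μ ∈ ℂ^r, let ρ > 0 and κ₁, κ₂ ≥ 0, and define B̃ = (ρΩ + A⁻¹)⁻¹. Suppose the stationarity condition Q = κ₂ I_r − ρ B̃ᵀ − κ₁ ρ (B̃ μ μᴴ B̃)ᵀ holds (where ᵀ denotes transpose without conjugation). If rank(κ₂ I_r − ρ B̃ᵀ) ≥ r + 1 − N, then rank(Ω) ≤ N. -/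
open Matrix ComplexOrder

theorem Matrix.rank_add_le_rank_add_rank {m n K : Type*} [Finite m] [Fintype n] [Field K]
    (A B : Matrix m n K) : (A + B).rank ≤ A.rank + B.rank := by
  unfold Matrix.rank
  rw [mulVecLin_add]
  exact (Submodule.finrank_mono (LinearMap.range_add_le _ _)).trans
    (Submodule.finrank_add_le_finrank_add_finrank _ _)

/-- Proposition 2: a sufficient condition from the KKT conditions ensuring
that the SDR solution satisfies the rank constraint `rank Ω ≤ N`. -/
theorem stmt_0 (r N : ℕ) (hN : 0 < N) (hNr : N ≤ r)
    (Ω Q : Matrix (Fin r) (Fin r) ℂ)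
    (hΩ : Ω.PosSemidef) (hQ : Q.PosSemidef)
    (hQΩ : Q * Ω = 0)
    (A : Matrix (Fin r) (Fin r) ℂ) (hA : A.PosDef)
    (μ : Fin r → ℂ) (ρ κ₁ κ₂ : ℝ)
    (hρ : 0 < ρ) (hκ₁ : 0 ≤ κ₁) (hκ₂ : 0 ≤ κ₂)
    (B : Matrix (Fin r) (Fin r) ℂ)
    (hB : B = ((ρ : ℂ) • Ω + A⁻¹)⁻¹)
    (hstat : Q = (κ₂ : ℂ) • (1 : Matrix (Fin r) (Fin r) ℂ)
      - (ρ : ℂ) • Bᵀ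
      - ((κ₁ : ℂ) * (ρ : ℂ)) • (B * vecMulVec μ (star μ) * B)ᵀ)
    (hrank : ((κ₂ : ℂ) • (1 : Matrix (Fin r) (Fin r) ℂ) - (ρ : ℂ) • Bᵀ).rank
      ≥ r + 1 - N) :
    Ω.rank ≤ N := by
  have hsum : (κ₂ : ℂ) • (1 : Matrix (Fin r) (Fin r) ℂ) - (ρ : ℂ) • Bᵀ
      = Q + (((κ₁ : ℂ) * (ρ : ℂ)) • (B * vecMulVec μ (star μ) * B))ᵀ := by
    rw [hstat, transpose_smul, sub_add_cancel]
  have hone : (((κ₁ : ℂ) * (ρ : ℂ)) • (B * vecMulVec μ (star μ) * B))ᵀ.rank ≤ 1 := by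
    rw [rank_transpose, ← smul_mul, ← smul_mul]
    exact (rank_mul_le_left _ _).trans
      ((rank_mul_le_right _ _).trans (rank_vecMulVec_le _ _))
  have hadd := Matrix.rank_add_le_rank_add_rank Q (((κ₁ : ℂ) * (ρ : ℂ)) • (B * vecMulVec μ (star μ) * B))ᵀ
  rw [← hsum] at hadd
  have hzero : Q.rank + Ω.rank ≤ r := by
    simpa using Matrix.rank_add_rank_le_card_of_mul_eq_zero hQΩ
  omega
end

section
/- Let X, X̂ ∈ ℂ^{m×n} be arbitrary matrices and let Y, Ŷ ∈ ℂ^{n×n} be Hermitian positive definite matrices. Then tr(X Y⁻¹ Xᴴ) ≥ tr(X̂ Ŷ⁻¹ X̂ᴴ) + 2 Re(tr((X − X̂) Ŷ⁻¹ X̂ᴴ)) − tr(X̂ Ŷ⁻¹ (Y − Ŷ) Ŷ⁻¹ X̂ᴴ). -/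
open Matrix ComplexOrder

/-- Completing the square in the positive definite weight `Y`. -/
theorem two_re_trace_sub_le_re_trace_mul_inv_mul {m n : Type*} [Fintype m] [Fintype n]
    [DecidableEq n] (X W : Matrix m n ℂ) {Y : Matrix n n ℂ} (hY : Y.PosDef) :
    2 * (X * Wᴴ).trace.re - (W * Y * Wᴴ).trace.re ≤ (X * Y⁻¹ * Xᴴ).trace.re := by
  have hdet : IsUnit Y.det := (isUnit_iff_isUnit_det Y).mp hY.isUnit
  have hsq : (X - W * Y) * Y⁻¹ * (X - W * Y)ᴴ
      = X * Y⁻¹ * Xᴴ - X * Wᴴ - (W * Xᴴ - W * Y * Wᴴ) := by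
    rw [Matrix.sub_mul, mul_nonsing_inv_cancel_right _ _ hdet, conjTranspose_sub,
      conjTranspose_mul, hY.isHermitian.eq, Matrix.sub_mul, Matrix.mul_sub, Matrix.mul_sub,
      ← Matrix.mul_assoc (X * Y⁻¹), nonsing_inv_mul_cancel_right _ _ hdet, ← Matrix.mul_assoc W]
  have hconj : (W * Xᴴ).trace.re = (X * Wᴴ).trace.re := by
    rw [← conjTranspose_conjTranspose W, ← conjTranspose_mul, trace_conjTranspose,
      conjTranspose_conjTranspose]
    simp
  have hnonneg := (hY.inv.posSemidef.mul_mul_conjTranspose_same (X - W * Y)).trace_nonneg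
  rw [hsq] at hnonneg
  have hre := (Complex.le_def.mp hnonneg).1
  simp only [trace_sub, Complex.sub_re, Complex.zero_re, hconj] at hre
  linarith

/-- The base trace inequality used for the SCA surrogates:
`tr(X Y⁻¹ Xᴴ) ≥ tr(X̂ Ŷ⁻¹ X̂ᴴ) + 2 Re tr((X − X̂) Ŷ⁻¹ X̂ᴴ) − tr(X̂ Ŷ⁻¹ (Y − Ŷ) Ŷ⁻¹ X̂ᴴ)`. -/
theorem stmt_2 (m n : ℕ) (X Xh : Matrix (Fin m) (Fin n) ℂ)
    (Y Yh : Matrix (Fin n) (Fin n) ℂ) (hY : Y.PosDef) (hYh : Yh.PosDef) :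
    (Matrix.trace (X * Y⁻¹ * Xᴴ)).re ≥
      (Matrix.trace (Xh * Yh⁻¹ * Xhᴴ)).re
        + 2 * (Matrix.trace ((X - Xh) * Yh⁻¹ * Xhᴴ)).re
        - (Matrix.trace (Xh * Yh⁻¹ * (Y - Yh) * Yh⁻¹ * Xhᴴ)).re := by
  have hdet : IsUnit Yh.det := (isUnit_iff_isUnit_det Yh).mp hYh.isUnit
  have h := two_re_trace_sub_le_re_trace_mul_inv_mul X (Xh * Yh⁻¹) hY
  rw [conjTranspose_mul, hYh.inv.isHermitian.eq] at h
  simp only [← Matrix.mul_assoc] at h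
  simp only [Matrix.sub_mul, Matrix.mul_sub, trace_sub, Complex.sub_re,
    nonsing_inv_mul_cancel_right _ _ hdet]
  linarith
end

section
/- Let ω ∈ ℂ^r, C ∈ ℂ^{r×r}, and M, M̂ ∈ ℂ^{r×N}. Define G = Mᴴ Cᴴ C M + I_N and Ĝ = M̂ᴴ Cᴴ C M̂ + I_N. Then −ωᴴ C M G⁻¹ Mᴴ Cᴴ ω ≤ −2 Re(ωᴴ C M Ĝ⁻¹ M̂ᴴ Cᴴ ω) + ωᴴ C M̂ Ĝ⁻¹ G Ĝ⁻¹ M̂ᴴ Cᴴ ω. -/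
open Matrix

section

open scoped ComplexOrder

/-- A Young-type inequality for the dual pair of quadratic forms of `G` and `G⁻¹`. -/
theorem Matrix.PosDef.two_mul_re_dotProduct_le {n : Type*} [Fintype n] [DecidableEq n]
    {G : Matrix n n ℂ} (hG : G.PosDef) (a b : n → ℂ) :
    2 * (star a ⬝ᵥ b).re ≤ (star a ⬝ᵥ G⁻¹ *ᵥ a).re + (star b ⬝ᵥ G *ᵥ b).re := by
  have hdet : IsUnit G.det := (Matrix.isUnit_iff_isUnit_det G).1 hG.isUnit
  have hnonneg : 0 ≤ (star (G⁻¹ *ᵥ a - b) ⬝ᵥ G *ᵥ (G⁻¹ *ᵥ a - b)).re :=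
    hG.posSemidef.re_dotProduct_nonneg _
  have hcancel : G *ᵥ (G⁻¹ *ᵥ a) = a := by
    rw [mulVec_mulVec, mul_nonsing_inv _ hdet, one_mulVec]
  have hstar : star (G⁻¹ *ᵥ a) = star a ᵥ* G⁻¹ := by
    rw [star_mulVec, hG.isHermitian.inv.eq]
  have hcross : star (G⁻¹ *ᵥ a) ⬝ᵥ G *ᵥ b = star a ⬝ᵥ b := by
    rw [hstar, dotProduct_mulVec, vecMul_vecMul, nonsing_inv_mul _ hdet, vecMul_one]
  have hsymm : (star b ⬝ᵥ a).re = (star a ⬝ᵥ b).re := by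
    rw [star_dotProduct, Complex.star_def, Complex.conj_re]
  have hquad : star (G⁻¹ *ᵥ a) ⬝ᵥ a = star a ⬝ᵥ G⁻¹ *ᵥ a := by
    rw [hstar, dotProduct_mulVec]
  rw [mulVec_sub, hcancel, star_sub, sub_dotProduct, dotProduct_sub, dotProduct_sub,
    hcross, hquad] at hnonneg
  simp only [Complex.sub_re, hsymm] at hnonneg
  linarith

theorem Matrix.posDef_conjTranspose_mul_mul_add_one {l m n : Type*} [Fintype l] [Fintype m]
    [Fintype n] [DecidableEq n] (C : Matrix l m ℂ) (X : Matrix m n ℂ) :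
    (Xᴴ * Cᴴ * C * X + 1).PosDef := by
  have h := posSemidef_conjTranspose_mul_self (C * X)
  rw [conjTranspose_mul, ← Matrix.mul_assoc] at h
  exact PosDef.posSemidef_add h PosDef.one

end

/-- First upper bound of Proposition 3 (the convex surrogate for
`f₁(M) = −ωᴴ C M G⁻¹ Mᴴ Cᴴ ω`). -/
theorem stmt_4 (r N : ℕ) (ω : Fin r → ℂ) (C : Matrix (Fin r) (Fin r) ℂ)
    (M Mh : Matrix (Fin r) (Fin N) ℂ)
    (G Gh : Matrix (Fin N) (Fin N) ℂ)
    (hG : G = Mᴴ * Cᴴ * C * M + 1)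
    (hGh : Gh = Mhᴴ * Cᴴ * C * Mh + 1) :
    -(star ω ⬝ᵥ (C * M * G⁻¹ * Mᴴ * Cᴴ).mulVec ω).re ≤
      -2 * (star ω ⬝ᵥ (C * M * Gh⁻¹ * Mhᴴ * Cᴴ).mulVec ω).re
        + (star ω ⬝ᵥ (C * Mh * Gh⁻¹ * G * Gh⁻¹ * Mhᴴ * Cᴴ).mulVec ω).re := by
  have hGpos := posDef_conjTranspose_mul_mul_add_one C M
  rw [← hG] at hGpos
  have hGhinv : (Gh⁻¹)ᴴ = Gh⁻¹ := by
    rw [conjTranspose_nonsing_inv, hGh]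
    simp [Matrix.mul_assoc]
  have h := hGpos.two_mul_re_dotProduct_le ((Mᴴ * Cᴴ) *ᵥ ω) ((Gh⁻¹ * Mhᴴ * Cᴴ) *ᵥ ω)
  simp only [star_mulVec, conjTranspose_mul, conjTranspose_conjTranspose, hGhinv,
    ← dotProduct_mulVec, mulVec_mulVec, ← Matrix.mul_assoc] at h
  linarith
end

section
/- Let C ∈ ℂ^{r×r} and M, M̂ ∈ ℂ^{r×N}. Define G = Mᴴ Cᴴ C M + I_N, Ĝ = M̂ᴴ Cᴴ C M̂ + I_N, P = I_r − C M G⁻¹ Mᴴ Cᴴ, P̂ = I_r − C M̂ Ĝ⁻¹ M̂ᴴ Cᴴ, and Ξ = Ĝ⁻¹ M̂ᴴ Cᴴ P̂⁻¹ C M̂ Ĝ⁻¹. Then ln det(P) ≤ tr(Mᴴ Cᴴ C M Ξ) − 2 Re(tr(Mᴴ Cᴴ P̂⁻¹ C M̂ Ĝ⁻¹)) + tr(Ξ) + ln det(P̂) + tr(P̂⁻¹ − I_r), with equality when M = M̂. -/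
open Matrix

open scoped ComplexOrder MatrixOrder

namespace Matrix

variable {m n : Type*} [Fintype m] [Fintype n]

/-- `log det S ≤ tr S - n` for positive definite `S`. -/
theorem PosDef.log_det_le_trace_sub [DecidableEq n] {S : Matrix n n ℂ} (hS : S.PosDef) :
    Real.log S.det.re ≤ S.trace.re - Fintype.card n := by
  have hdet : S.det.re = ∏ i, hS.1.eigenvalues i := by
    rw [hS.1.det_eq_prod_eigenvalues]
    norm_cast
  have htr : S.trace.re = ∑ i, hS.1.eigenvalues i := by
    rw [hS.1.trace_eq_sum_eigenvalues]
    norm_cast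
  rw [hdet, htr, Real.log_prod fun i _ => (hS.eigenvalues_pos i).ne']
  calc ∑ i, Real.log (hS.1.eigenvalues i) ≤ ∑ i, (hS.1.eigenvalues i - 1) :=
        Finset.sum_le_sum fun i _ => Real.log_le_sub_one_of_pos (hS.eigenvalues_pos i)
    _ = _ := by simp

theorem PosDef.exists_isUnit_eq_conjTranspose_mul_self [DecidableEq n] {Q : Matrix n n ℂ}
    (hQ : Q.PosDef) :
    ∃ R : Matrix n n ℂ, IsUnit R ∧ Q = Rᴴ * R := by
  obtain ⟨R, hR⟩ := CStarAlgebra.nonneg_iff_eq_star_mul_self.1 hQ.posSemidef.nonneg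
  refine ⟨R, ?_, hR⟩
  have h := hQ.isUnit
  rw [hR] at h
  rw [isUnit_iff_isUnit_det, det_mul] at h
  exact (isUnit_iff_isUnit_det R).2 (isUnit_of_mul_isUnit_right h)

/-- First-order concavity of `log det` on positive definite matrices. -/
theorem PosDef.log_det_le_log_det_add_trace [DecidableEq n] {P Q : Matrix n n ℂ}
    (hP : P.PosDef) (hQ : Q.PosDef) :
    Real.log P.det.re ≤ Real.log Q.det.re + (Q⁻¹ * P).trace.re - Fintype.card n := by
  obtain ⟨R, hR, hQR⟩ := hQ.inv.exists_isUnit_eq_conjTranspose_mul_self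
  have hS : (R * P * Rᴴ).PosDef := (IsUnit.posDef_star_right_conjugate_iff hR).2 hP
  have htr : (R * P * Rᴴ).trace = (Q⁻¹ * P).trace := by
    rw [hQR, trace_mul_cycle]
  have hdet : (R * P * Rᴴ).det * Q.det = P.det := by
    have h : Rᴴ.det * R.det * Q.det = 1 := by
      rw [← det_mul, ← hQR, ← det_mul, nonsing_inv_mul _ ((isUnit_iff_isUnit_det _).1 hQ.isUnit),
        det_one]
    rw [det_mul, det_mul]
    linear_combination P.det * h
  have h1 := Complex.pos_iff.1 hS.det_pos
  have h2 := Complex.pos_iff.1 hQ.det_pos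
  have hre : P.det.re = (R * P * Rᴴ).det.re * Q.det.re := by
    rw [← hdet, Complex.mul_re, ← h1.2]
    ring
  have h := hS.log_det_le_trace_sub
  rw [hre, Real.log_mul h1.1.ne' h2.1.ne']
  rw [htr] at h
  linarith

theorem posDef_conjTranspose_mul_self_add_one [DecidableEq n] (A : Matrix m n ℂ) :
    (Aᴴ * A + 1).PosDef :=
  PosDef.posSemidef_add (posSemidef_conjTranspose_mul_self A) PosDef.one

/-- `1 - A (AᴴA + 1)⁻¹ Aᴴ = (1 + AAᴴ)⁻¹` is positive definite. -/
theorem posDef_one_sub_mul_inv_mul [DecidableEq m] [DecidableEq n] (A : Matrix m n ℂ) :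
    (1 - A * (Aᴴ * A + 1)⁻¹ * Aᴴ).PosDef := by
  have hG : IsUnit (Aᴴ * A + 1).det :=
    (isUnit_iff_isUnit_det _).1 (posDef_conjTranspose_mul_self_add_one A).isUnit
  have hW : (A * Aᴴ + 1).PosDef := by
    simpa using posDef_conjTranspose_mul_self_add_one Aᴴ
  have h : (1 - A * (Aᴴ * A + 1)⁻¹ * Aᴴ) * (A * Aᴴ + 1) = 1 := by
    have h1 : A * (Aᴴ * A + 1)⁻¹ * Aᴴ * (A * Aᴴ + 1)
        = A * ((Aᴴ * A + 1)⁻¹ * (Aᴴ * A + 1)) * Aᴴ := by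
      simp only [Matrix.mul_add, Matrix.add_mul, Matrix.mul_assoc, Matrix.mul_one]
    rw [Matrix.sub_mul, h1, nonsing_inv_mul _ hG]
    simp
  rw [← inv_eq_left_inv h]
  exact hW.inv

/-- Completing the square in `X`. -/
theorem one_sub_mul_add_eq_add_mul_mul_conjTranspose [DecidableEq m] [DecidableEq n]
    (A X : Matrix m n ℂ) :
    X * (Aᴴ * A) * Xᴴ - X * Aᴴ - A * Xᴴ + X * Xᴴ + 1
      = (1 - A * (Aᴴ * A + 1)⁻¹ * Aᴴ)
        + (X - A * (Aᴴ * A + 1)⁻¹) * (Aᴴ * A + 1) * (X - A * (Aᴴ * A + 1)⁻¹)ᴴ := by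
  have hGd := posDef_conjTranspose_mul_self_add_one A
  have hG : IsUnit (Aᴴ * A + 1).det := (isUnit_iff_isUnit_det _).1 hGd.isUnit
  have hH : ((Aᴴ * A + 1)⁻¹)ᴴ = (Aᴴ * A + 1)⁻¹ := hGd.inv.isHermitian
  have h1 : (X - A * (Aᴴ * A + 1)⁻¹) * (Aᴴ * A + 1) = X * (Aᴴ * A + 1) - A := by
    rw [Matrix.sub_mul, Matrix.mul_assoc A, nonsing_inv_mul _ hG, Matrix.mul_one]
  have h2 : (X * (Aᴴ * A + 1)) * ((Aᴴ * A + 1)⁻¹ * Aᴴ) = X * Aᴴ := by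
    rw [Matrix.mul_assoc, ← Matrix.mul_assoc _ _ Aᴴ, mul_nonsing_inv _ hG, Matrix.one_mul]
  rw [h1, conjTranspose_sub, conjTranspose_mul, hH, Matrix.mul_sub, Matrix.sub_mul, Matrix.sub_mul,
    h2, Matrix.mul_add, Matrix.add_mul, Matrix.mul_one, ← Matrix.mul_assoc A]
  abel

theorem PosSemidef.trace_mul_mul_mul_conjTranspose_nonneg {Q : Matrix m m ℂ} {G : Matrix n n ℂ}
    (hQ : Q.PosSemidef) (hG : G.PosSemidef) (Y : Matrix m n ℂ) :
    0 ≤ (Q * (Y * G * Yᴴ)).trace.re := by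
  classical
  obtain ⟨R, rfl⟩ := CStarAlgebra.nonneg_iff_eq_star_mul_self.1 hQ.nonneg
  have h : (Rᴴ * R * (Y * G * Yᴴ)).trace = ((R * Y) * G * (R * Y)ᴴ).trace := by
    rw [Matrix.mul_assoc, trace_mul_comm, conjTranspose_mul]
    simp only [Matrix.mul_assoc]
  rw [star_eq_conjTranspose, h]
  exact (Complex.nonneg_iff.1 (hG.mul_mul_conjTranspose_same (R * Y)).trace_nonneg).1

/-- The trace terms of the surrogate, rewritten as one trace against `Q`. -/
theorem IsHermitian.trace_surrogate_eq [DecidableEq m] {Q : Matrix m m ℂ} (hQ : Q.IsHermitian)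
    (A X : Matrix m n ℂ) :
    (Aᴴ * A * (Xᴴ * Q * X)).trace.re - 2 * (Aᴴ * Q * X).trace.re + (Xᴴ * Q * X).trace.re
        + (Q - 1).trace.re
      = (Q * (X * (Aᴴ * A) * Xᴴ - X * Aᴴ - A * Xᴴ + X * Xᴴ + 1)).trace.re - Fintype.card m := by
  have h1 : (Aᴴ * A * (Xᴴ * Q * X)).trace = (Q * (X * (Aᴴ * A) * Xᴴ)).trace := by
    rw [trace_mul_comm, Matrix.mul_assoc, Matrix.mul_assoc, trace_mul_comm]
    simp only [Matrix.mul_assoc]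
  have h2 : (Aᴴ * Q * X).trace = (Q * (X * Aᴴ)).trace := by
    rw [Matrix.mul_assoc, trace_mul_comm, Matrix.mul_assoc]
  have h3 : (Q * (A * Xᴴ)).trace.re = (Aᴴ * Q * X).trace.re := by
    have h : (Aᴴ * Q * X).trace = star (Q * (A * Xᴴ)).trace := by
      rw [← trace_conjTranspose, h2, trace_mul_comm]
      simp [hQ.eq, Matrix.mul_assoc]
    rw [h]
    simp
  have h4 : (Xᴴ * Q * X).trace = (Q * (X * Xᴴ)).trace := by
    rw [Matrix.mul_assoc, trace_mul_comm, Matrix.mul_assoc]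
  simp only [Matrix.mul_add, Matrix.mul_sub, trace_add, trace_sub, Complex.add_re, Complex.sub_re,
    h3, h1, h4, Matrix.mul_one, trace_one, Complex.natCast_re, ← h2]
  ring

end Matrix

/-- Second upper bound of Proposition 3 (the convex surrogate for
`f₂(M) = ln det P` with `P = I − C M G⁻¹ Mᴴ Cᴴ`), with equality when `M = M̂`. -/
theorem stmt_6 (r N : ℕ) (C : Matrix (Fin r) (Fin r) ℂ)
    (M Mh : Matrix (Fin r) (Fin N) ℂ)
    (G Gh : Matrix (Fin N) (Fin N) ℂ)
    (P Ph : Matrix (Fin r) (Fin r) ℂ)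
    (Ξ : Matrix (Fin N) (Fin N) ℂ)
    (hG : G = Mᴴ * Cᴴ * C * M + 1)
    (hGh : Gh = Mhᴴ * Cᴴ * C * Mh + 1)
    (hP : P = 1 - C * M * G⁻¹ * Mᴴ * Cᴴ)
    (hPh : Ph = 1 - C * Mh * Gh⁻¹ * Mhᴴ * Cᴴ)
    (hΞ : Ξ = Gh⁻¹ * Mhᴴ * Cᴴ * Ph⁻¹ * C * Mh * Gh⁻¹) :
    Real.log P.det.re ≤
      (Matrix.trace (Mᴴ * Cᴴ * C * M * Ξ)).re
        - 2 * (Matrix.trace (Mᴴ * Cᴴ * Ph⁻¹ * C * Mh * Gh⁻¹)).re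
        + (Matrix.trace Ξ).re
        + Real.log Ph.det.re
        + (Matrix.trace (Ph⁻¹ - 1)).re
    ∧ (M = Mh →
      Real.log P.det.re =
        (Matrix.trace (Mᴴ * Cᴴ * C * M * Ξ)).re
          - 2 * (Matrix.trace (Mᴴ * Cᴴ * Ph⁻¹ * C * Mh * Gh⁻¹)).re
          + (Matrix.trace Ξ).re
          + Real.log Ph.det.re
          + (Matrix.trace (Ph⁻¹ - 1)).re) := by
  have hA : Mᴴ * Cᴴ * C * M = (C * M)ᴴ * (C * M) := by
    simp only [conjTranspose_mul, Matrix.mul_assoc]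
  have hB : Mhᴴ * Cᴴ * C * Mh = (C * Mh)ᴴ * (C * Mh) := by
    simp only [conjTranspose_mul, Matrix.mul_assoc]
  rw [hA] at hG
  rw [hB] at hGh
  have hP' : P = 1 - C * M * ((C * M)ᴴ * (C * M) + 1)⁻¹ * (C * M)ᴴ := by
    rw [hP, hG, conjTranspose_mul C M]
    simp only [Matrix.mul_assoc]
  have hPh' : Ph = 1 - C * Mh * ((C * Mh)ᴴ * (C * Mh) + 1)⁻¹ * (C * Mh)ᴴ := by
    rw [hPh, hGh, conjTranspose_mul C Mh]
    simp only [Matrix.mul_assoc]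
  have hPd : P.PosDef := hP' ▸ posDef_one_sub_mul_inv_mul (C * M)
  have hPhd : Ph.PosDef := hPh' ▸ posDef_one_sub_mul_inv_mul (C * Mh)
  have hGd : G.PosDef := hG ▸ posDef_conjTranspose_mul_self_add_one (C * M)
  have hGhd : Gh.PosDef := hGh ▸ posDef_conjTranspose_mul_self_add_one (C * Mh)
  have hX : Ξ = (C * Mh * Gh⁻¹)ᴴ * Ph⁻¹ * (C * Mh * Gh⁻¹) := by
    rw [hΞ, conjTranspose_mul, conjTranspose_mul, hGhd.inv.isHermitian.eq]
    simp only [Matrix.mul_assoc]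
  have hL : Mᴴ * Cᴴ * Ph⁻¹ * C * Mh * Gh⁻¹ = (C * M)ᴴ * Ph⁻¹ * (C * Mh * Gh⁻¹) := by
    simp only [conjTranspose_mul, Matrix.mul_assoc]
  have key := hPhd.inv.isHermitian.trace_surrogate_eq (C * M) (C * Mh * Gh⁻¹)
  rw [one_sub_mul_add_eq_add_mul_mul_conjTranspose, ← hP', ← hG, Matrix.mul_add, trace_add,
    Complex.add_re, ← hX, ← hL, ← hA] at key
  constructor
  · have h1 := hPd.log_det_le_log_det_add_trace hPhd
    have h2 := hPhd.inv.posSemidef.trace_mul_mul_mul_conjTranspose_nonneg hGd.posSemidef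
      (C * Mh * Gh⁻¹ - C * M * G⁻¹)
    linarith
  · rintro rfl
    obtain rfl : G = Gh := hG.trans hGh.symm
    obtain rfl : P = Ph := hP.trans hPh.symm
    rw [nonsing_inv_mul _ ((isUnit_iff_isUnit_det _).1 hPd.isUnit)] at key
    simp only [sub_self, Matrix.zero_mul, Matrix.mul_zero, trace_zero, trace_one, Complex.zero_re,
      Complex.natCast_re] at key
    linarith
end

section
/- Let N be a positive integer, α > 0, and λ₁, …, λ_N > 0. For c > 0, let q*(c) ∈ ℝ^N be the water-filling solution of max Σ_{i=1}^N ln(1 + c λ_i q_i) subject to q_i ≥ 0 and Σ_{i=1}^N q_i ≤ α, i.e., q_i*(c) = max(1/κ(c) − 1/(c λ_i), 0) where κ(c) > 0 is chosen so that Σ_{i=1}^N q_i*(c) = α. Then for every i, q_i*(c) → α/N as c → ∞. -/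
open Filter

/-- Truncating `a - b` at zero moves it away from `a ≥ 0` by at most `b ≥ 0`. -/
lemma abs_max_sub_zero_sub_le {a b : ℝ} (ha : 0 ≤ a) (hb : 0 ≤ b) :
    |max (a - b) 0 - a| ≤ b := by
  rcases max_cases (a - b) 0 with ⟨h, _⟩ | ⟨h, _⟩ <;> rw [h, abs_le] <;>
    constructor <;> linarith

/-- If the entries of a finite family with constant sum `α` all approach a common value,
then each of them tends to the average `α / N`. -/
lemma tendsto_average_of_tendsto_sub {β : Type*} {l : Filter β} {N : ℕ} (hN : 0 < N) {α : ℝ}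
    {q : β → Fin N → ℝ} {w : β → ℝ} (hsum : ∀ᶠ c in l, ∑ i, q c i = α)
    (hq : ∀ i, Tendsto (fun c => q c i - w c) l (nhds 0)) (i : Fin N) :
    Tendsto (fun c => q c i) l (nhds (α / N)) := by
  have hN' : (N : ℝ) ≠ 0 := by positivity
  have hmean : Tendsto (fun c => (∑ j, (q c j - w c)) / N) l (nhds 0) := by
    simpa using (tendsto_finsetSum Finset.univ fun j _ => hq j).div_const (N : ℝ)
  have hlim : Tendsto (fun c => α / N - (∑ j, (q c j - w c)) / N + (q c i - w c)) l
      (nhds (α / N)) := by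
    simpa using (hmean.const_sub (α / N)).add (hq i)
  refine hlim.congr' ?_
  filter_upwards [hsum] with c hc
  rw [Finset.sum_sub_distrib, hc]
  simp only [Finset.sum_const, Finset.card_univ, Fintype.card_fin, nsmul_eq_mul]
  field_simp
  ring

/-- Asymptotic claim of Proposition 4: as the SNR parameter `c → ∞`, each component of
the water-filling power allocation converges to the uniform allocation `α / N`. -/
theorem stmt_9 (N : ℕ) (hN : 0 < N) (α : ℝ) (hα : 0 < α)
    (lam : Fin N → ℝ) (hlam : ∀ i, 0 < lam i)
    (κ : ℝ → ℝ) (hκpos : ∀ c > 0, 0 < κ c)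
    (hκsum : ∀ c > 0, ∑ i, max (1 / κ c - 1 / (c * lam i)) 0 = α)
    (qstar : ℝ → Fin N → ℝ)
    (hqstar : ∀ c > 0, ∀ i, qstar c i = max (1 / κ c - 1 / (c * lam i)) 0) :
    ∀ i, Tendsto (fun c => qstar c i) atTop (nhds (α / N)) := by
  refine tendsto_average_of_tendsto_sub (w := fun c => 1 / κ c) hN ?_ fun i => ?_
  · filter_upwards [eventually_gt_atTop 0] with c hc
    simp only [hqstar c hc, hκsum c hc]
  · have hbound : Tendsto (fun c : ℝ => 1 / (c * lam i)) atTop (nhds 0) :=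
      tendsto_const_nhds.div_atTop (tendsto_id.atTop_mul_const (hlam i))
    refine squeeze_zero_norm' ?_ hbound
    filter_upwards [eventually_gt_atTop 0] with c hc
    rw [Real.norm_eq_abs, hqstar c hc]
    exact abs_max_sub_zero_sub_le (one_div_pos.2 (hκpos c hc)).le
      (one_div_pos.2 (mul_pos hc (hlam i))).le
end

section
/- Let Ω ∈ ℂ^{r×r} be Hermitian positive semidefinite, A ∈ ℂ^{r×r} Hermitian positive definite, and μ ∈ ℂ^r. Then the function g(ρ) = μᴴ (ρ Ω + A⁻¹)⁻¹ μ − ln det(ρ Ω + A⁻¹) is nonincreasing on [0, ∞): for all 0 ≤ ρ₁ ≤ ρ₂, g(ρ₂) ≤ g(ρ₁). -/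
open Matrix ComplexOrder

namespace Matrix

variable {n 𝕜 : Type*} [Fintype n] [DecidableEq n] [RCLike 𝕜]

/-- A matrix dominating the identity has determinant at least one. -/
theorem PosSemidef.one_le_det_one_add {Q : Matrix n n 𝕜} (hQ : Q.PosSemidef) :
    1 ≤ (1 + Q).det := by
  have hH : (1 + Q).IsHermitian := isHermitian_one.add hQ.isHermitian
  have h (i : n) : 1 ≤ hH.eigenvalues i := by
    have hv : (hH.eigenvectorBasis i).ofLp ⬝ᵥ star (hH.eigenvectorBasis i).ofLp = 1 := by
      rw [← EuclideanSpace.inner_eq_star_dotProduct, inner_self_eq_norm_sq_to_K]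
      simp
    rw [hH.eigenvalues_eq, add_mulVec, one_mulVec, dotProduct_add, dotProduct_comm, hv, map_add,
      RCLike.one_re]
    linarith [hQ.re_dotProduct_nonneg (hH.eigenvectorBasis i).ofLp]
  rw [hH.det_eq_prod_eigenvalues, ← RCLike.ofReal_prod, ← RCLike.ofReal_one,
    RCLike.ofReal_le_ofReal]
  exact Finset.one_le_prod fun i _ ↦ h i

open scoped MatrixOrder in
/-- The determinant does not decrease when a positive semidefinite matrix is added to a positive
definite one. -/
theorem PosDef.det_le_det_add {B P : Matrix n n 𝕜} (hB : B.PosDef) (hP : P.PosSemidef) :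
    B.det ≤ (B + P).det := by
  obtain ⟨L, rfl⟩ := CStarAlgebra.nonneg_iff_eq_star_mul_self.mp hP.nonneg
  have hQ := hB.inv.posSemidef.mul_mul_conjTranspose_same L
  rw [star_eq_conjTranspose, det_add_mul _ _ hB.det_pos.ne'.isUnit]
  exact le_mul_of_one_le_right hB.det_pos.le hQ.one_le_det_one_add

/-- Matrix inversion is antitone on positive definite matrices. -/
theorem PosDef.posSemidef_inv_sub_inv_add {B P : Matrix n n 𝕜} (hB : B.PosDef)
    (hP : P.PosSemidef) : (B⁻¹ - (B + P)⁻¹).PosSemidef := by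
  have hC := hB.add_posSemidef hP
  have hBu := (isUnit_iff_isUnit_det _).mp hB.isUnit
  have hCu := (isUnit_iff_isUnit_det _).mp hC.isUnit
  have h1 : (B + P) * B⁻¹ * (B + P) - (B + P) = P + P * B⁻¹ * P := by
    simp only [add_mul, mul_add, mul_nonsing_inv _ hBu, one_mul, mul_assoc,
      nonsing_inv_mul _ hBu, mul_one]
    abel
  have h2 : B⁻¹ - (B + P)⁻¹ = (B + P)⁻¹ * (P + P * B⁻¹ * P) * (B + P)⁻¹ := by
    rw [← h1, mul_sub, sub_mul, nonsing_inv_mul _ hCu, one_mul, mul_assoc (B + P),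
      nonsing_inv_mul_cancel_left _ _ hCu, mul_nonsing_inv_cancel_right _ _ hCu]
  have h3 : (P + P * B⁻¹ * P).PosSemidef := by
    have := hB.inv.posSemidef.conjTranspose_mul_mul_same P
    rw [hP.isHermitian.eq] at this
    exact hP.add this
  have h4 := h3.conjTranspose_mul_mul_same (B + P)⁻¹
  rwa [hC.inv.isHermitian.eq, ← h2] at h4

end Matrix

/-- Monotonicity of the log-Chernoff bound in `ρ`: the function
`g(ρ) = μᴴ (ρΩ + A⁻¹)⁻¹ μ − ln det(ρΩ + A⁻¹)` is nonincreasing on `[0, ∞)`. -/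
theorem stmt_16 (r : ℕ) (Ω : Matrix (Fin r) (Fin r) ℂ) (hΩ : Ω.PosSemidef)
    (A : Matrix (Fin r) (Fin r) ℂ) (hA : A.PosDef) (μ : Fin r → ℂ)
    (g : ℝ → ℝ)
    (hg : ∀ ρ : ℝ, g ρ =
      (star μ ⬝ᵥ (((ρ : ℂ) • Ω + A⁻¹)⁻¹).mulVec μ).re
        - Real.log (((ρ : ℂ) • Ω + A⁻¹ : Matrix (Fin r) (Fin r) ℂ).det.re))
    (ρ₁ ρ₂ : ℝ) (hρ₁ : 0 ≤ ρ₁) (hρ₁₂ : ρ₁ ≤ ρ₂) :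
    g ρ₂ ≤ g ρ₁ := by
  have hB : ((ρ₁ : ℂ) • Ω + A⁻¹).PosDef :=
    PosDef.posSemidef_add (hΩ.smul (Complex.zero_le_real.mpr hρ₁)) hA.inv
  have hP : (((ρ₂ - ρ₁ : ℝ) : ℂ) • Ω).PosSemidef :=
    hΩ.smul (Complex.zero_le_real.mpr (sub_nonneg.mpr hρ₁₂))
  have hC : (ρ₂ : ℂ) • Ω + A⁻¹ = ((ρ₁ : ℂ) • Ω + A⁻¹) + ((ρ₂ - ρ₁ : ℝ) : ℂ) • Ω := by
    rw [Complex.ofReal_sub, sub_smul]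
    abel
  rw [hg, hg, hC]
  have hq := (hB.posSemidef_inv_sub_inv_add hP).re_dotProduct_nonneg μ
  rw [sub_mulVec, dotProduct_sub, map_sub, sub_nonneg] at hq
  have hd := Complex.le_def.mp (hB.det_le_det_add hP)
  exact sub_le_sub hq (Real.log_le_log (Complex.pos_iff.mp hB.det_pos).1 hd.1)
end
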